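/- arXiv:1306.0536 — 5 statements merged into one kernel-verified Lean document; each statement's English description precedes it below -/
import Mathlib

section
/- The 1D DFEM shape functions are linearly complete: if the finite-element nodal values reproduce linear functions at the element nodes, i.e. Σ_L N_L(x_I) = 1, Σ_L N_L(x_J) = 1, Σ_L N_L(x_I) x_L = x_I, Σ_L N_L(x_J) x_L = x_J, and the averaged nodal gradients satisfy Σ_L g_L^I = 0, Σ_L g_L^J = 0, Σ_L g_L^I x_L = 1, Σ_L g_L^J x_L = 1, then Σ_L N̂_L(x) x_L = x for every x ∈ ℝ. -/
/-- The 1D DFEM shape functions are linearly complete: they reproduce the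
linear field `x` exactly. -/
theorem dfem_shape_linear_completeness
    {ι : Type*} [Fintype ι]
    (xI xJ : ℝ) (hne : xI ≠ xJ)
    (φI ψI φJ ψJ : ℝ → ℝ)
    (hφI : φI = fun x => (1 + 2 * ((x - xI) / (xJ - xI))) * ((x - xJ) / (xJ - xI)) ^ 2)
    (hψI : ψI = fun x => (x - xI) * ((x - xJ) / (xJ - xI)) ^ 2)
    (hφJ : φJ = fun x => (1 - 2 * ((x - xJ) / (xJ - xI))) * ((x - xI) / (xJ - xI)) ^ 2)
    (hψJ : ψJ = fun x => (x - xJ) * ((x - xI) / (xJ - xI)) ^ 2)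
    (xL : ι → ℝ) (NI NJ gI gJ : ι → ℝ)
    (hNIsum : ∑ L, NI L = 1) (hNJsum : ∑ L, NJ L = 1)
    (hNIx : ∑ L, NI L * xL L = xI) (hNJx : ∑ L, NJ L * xL L = xJ)
    (hgIsum : ∑ L, gI L = 0) (hgJsum : ∑ L, gJ L = 0)
    (hgIx : ∑ L, gI L * xL L = 1) (hgJx : ∑ L, gJ L * xL L = 1)
    (Nhat : ι → ℝ → ℝ)
    (hNhat : ∀ L, Nhat L = fun x => φI x * NI L + ψI x * gI L + φJ x * NJ L + ψJ x * gJ L) :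
    ∀ x : ℝ, ∑ L, Nhat L x * xL L = x := by
  intro x
  have hd : xJ - xI ≠ 0 := sub_ne_zero.mpr hne.symm
  have hsum : ∑ L, Nhat L x * xL L = φI x * xI + ψI x + φJ x * xJ + ψJ x := by
    calc ∑ L, Nhat L x * xL L
        = ∑ L, (φI x * (NI L * xL L) + ψI x * (gI L * xL L)
            + φJ x * (NJ L * xL L) + ψJ x * (gJ L * xL L)) :=
          Finset.sum_congr rfl fun L _ => by rw [hNhat L]; ring
      _ = φI x * xI + ψI x + φJ x * xJ + ψJ x := by
          simp only [Finset.sum_add_distrib, ← Finset.mul_sum, hNIx, hNJx, hgIx, hgJx, mul_one]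
  rw [hsum, hφI, hψI, hφJ, hψJ]
  field_simp
  ring
end

section
/- The nodal-value basis function φ_I of the 2D double-interpolation element satisfies the interpolation conditions φ_I(x_I) = 1, φ_I(x_J) = 0, φ_I(x_K) = 0, and its gradient vanishes at all three vertices: ∂φ_I/∂x(x_A) = 0 and ∂φ_I/∂y(x_A) = 0 for each A ∈ {I, J, K}. -/
/-- The chain rule for the nodal shape function along a line, in terms of the area coordinates
`u`, `v`, `w` restricted to that line. -/
theorem HasDerivAt.nodal_shape {u v w : ℝ → ℝ} {u' v' w' t : ℝ}
    (hu : HasDerivAt u u' t) (hv : HasDerivAt v v' t) (hw : HasDerivAt w w' t) :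
    HasDerivAt
      (fun s => u s + u s ^ 2 * v s + u s ^ 2 * w s - u s * v s ^ 2 - u s * w s ^ 2)
      (u' * (1 + 2 * u t * v t + 2 * u t * w t - v t ^ 2 - w t ^ 2)
        + v' * (u t ^ 2 - 2 * u t * v t) + w' * (u t ^ 2 - 2 * u t * w t)) t := by
  refine ((((hu.add ((hu.pow 2).mul hv)).add ((hu.pow 2).mul hw)).sub
    (hu.mul (hv.pow 2))).sub (hu.mul (hw.pow 2))).congr_deriv ?_
  simp only [Pi.pow_apply]
  push_cast
  ring

theorem hasDerivAt_affine_div_fst (a b c d x y : ℝ) :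
    HasDerivAt (fun s => (a + b * s + c * y) / d) (b / d) x := by
  simpa using ((((hasDerivAt_id x).const_mul b).const_add a).add_const (c * y)).div_const d

theorem hasDerivAt_affine_div_snd (a b c d x y : ℝ) :
    HasDerivAt (fun s => (a + b * x + c * s) / d) (c / d) y := by
  simpa using (((hasDerivAt_id y).const_mul c).const_add (a + b * x)).div_const d


/-- The nodal-value basis function `φI` of the 2D double-interpolation element
takes the value 1 at node `I`, vanishes at nodes `J` and `K`, and its gradient
vanishes at all three vertices. -/
theorem dfem2d_phi_interpolation_conditions
    (xI yI xJ yJ xK yK : ℝ)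
    (aI bI cI aJ bJ cJ aK bK cK Δ2 : ℝ)
    (haI : aI = xJ * yK - xK * yJ) (hbI : bI = yJ - yK) (hcI : cI = xK - xJ)
    (haJ : aJ = xK * yI - xI * yK) (hbJ : bJ = yK - yI) (hcJ : cJ = xI - xK)
    (haK : aK = xI * yJ - xJ * yI) (hbK : bK = yI - yJ) (hcK : cK = xJ - xI)
    (hΔ : Δ2 = bJ * cK - bK * cJ) (hΔne : Δ2 ≠ 0)
    (LI LJ LK : ℝ → ℝ → ℝ)
    (hLI : LI = fun x y => (aI + bI * x + cI * y) / Δ2)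
    (hLJ : LJ = fun x y => (aJ + bJ * x + cJ * y) / Δ2)
    (hLK : LK = fun x y => (aK + bK * x + cK * y) / Δ2)
    (φI : ℝ → ℝ → ℝ)
    (hφI : φI = fun x y =>
      LI x y + (LI x y) ^ 2 * LJ x y + (LI x y) ^ 2 * LK x y
        - LI x y * (LJ x y) ^ 2 - LI x y * (LK x y) ^ 2) :
    φI xI yI = 1 ∧ φI xJ yJ = 0 ∧ φI xK yK = 0 ∧
    deriv (fun x => φI x yI) xI = 0 ∧ deriv (fun y => φI xI y) yI = 0 ∧
    deriv (fun x => φI x yJ) xJ = 0 ∧ deriv (fun y => φI xJ y) yJ = 0 ∧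
    deriv (fun x => φI x yK) xK = 0 ∧ deriv (fun y => φI xK y) yK = 0 := by
  have dx (x y : ℝ) := (hasDerivAt_affine_div_fst aI bI cI Δ2 x y).nodal_shape
    (hasDerivAt_affine_div_fst aJ bJ cJ Δ2 x y) (hasDerivAt_affine_div_fst aK bK cK Δ2 x y)
  have dy (x y : ℝ) := (hasDerivAt_affine_div_snd aI bI cI Δ2 x y).nodal_shape
    (hasDerivAt_affine_div_snd aJ bJ cJ Δ2 x y) (hasDerivAt_affine_div_snd aK bK cK Δ2 x y)
  have hII : (aI + bI * xI + cI * yI) / Δ2 = 1 := by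
    rw [div_eq_one_iff_eq hΔne]
    subst_vars
    ring
  have hIJ : (aI + bI * xJ + cI * yJ) / Δ2 = 0 := by
    rw [div_eq_zero_iff]
    left
    subst_vars
    ring
  have hIK : (aI + bI * xK + cI * yK) / Δ2 = 0 := by
    rw [div_eq_zero_iff]
    left
    subst_vars
    ring
  have hJI : (aJ + bJ * xI + cJ * yI) / Δ2 = 0 := by
    rw [div_eq_zero_iff]
    left
    subst_vars
    ring
  have hJJ : (aJ + bJ * xJ + cJ * yJ) / Δ2 = 1 := by
    rw [div_eq_one_iff_eq hΔne]
    subst_vars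
    ring
  have hJK : (aJ + bJ * xK + cJ * yK) / Δ2 = 0 := by
    rw [div_eq_zero_iff]
    left
    subst_vars
    ring
  have hKI : (aK + bK * xI + cK * yI) / Δ2 = 0 := by
    rw [div_eq_zero_iff]
    left
    subst_vars
    ring
  have hKJ : (aK + bK * xJ + cK * yJ) / Δ2 = 0 := by
    rw [div_eq_zero_iff]
    left
    subst_vars
    ring
  have hKK : (aK + bK * xK + cK * yK) / Δ2 = 1 := by
    rw [div_eq_one_iff_eq hΔne]
    subst_vars
    ring
  have hb : bI / Δ2 + bJ / Δ2 + bK / Δ2 = 0 := by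
    rw [hbI, hbJ, hbK]
    ring
  have hc : cI / Δ2 + cJ / Δ2 + cK / Δ2 = 0 := by
    rw [hcI, hcJ, hcK]
    ring
  simp only [hφI, hLI, hLJ, hLK]
  refine ⟨?_, ?_, ?_, (dx xI yI).deriv.trans ?_, (dy xI yI).deriv.trans ?_,
    (dx xJ yJ).deriv.trans ?_, (dy xJ yJ).deriv.trans ?_,
    (dx xK yK).deriv.trans ?_, (dy xK yK).deriv.trans ?_⟩ <;>
    simp only [hII, hIJ, hIK, hJI, hJJ, hJK, hKI, hKJ, hKK] <;>
    linarith
end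

section
/- The y-gradient basis function φ̃_I (denoted varphi_I) of the 2D double-interpolation element satisfies the interpolation conditions φ̃_I(x_A) = 0 for each vertex A ∈ {I, J, K}, ∂φ̃_I/∂x(x_A) = 0 for each A ∈ {I, J, K}, ∂φ̃_I/∂y(x_I) = 1, ∂φ̃_I/∂y(x_J) = 0, and ∂φ̃_I/∂y(x_K) = 0. -/
/-- Derivative of the cubic shape function `p (w u² + u v w / 2) - q (u² v + u v w / 2)` along a
curve on which the area coordinates are `u`, `v`, `w`. -/
theorem hasDerivAt_cubicShape {u v w : ℝ → ℝ} {u' v' w' t : ℝ} (p q : ℝ)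
    (hu : HasDerivAt u u' t) (hv : HasDerivAt v v' t) (hw : HasDerivAt w w' t) :
    HasDerivAt (fun s => p * (w s * u s ^ 2 + (1 / 2) * u s * v s * w s)
        - q * (u s ^ 2 * v s + (1 / 2) * u s * v s * w s))
      (p * (w' * u t ^ 2 + 2 * w t * u t * u'
          + (1 / 2) * (u' * v t * w t + u t * v' * w t + u t * v t * w'))
        - q * (2 * u t * u' * v t + u t ^ 2 * v'
          + (1 / 2) * (u' * v t * w t + u t * v' * w t + u t * v t * w'))) t := by
  have huvw := ((hu.const_mul (1 / 2)).mul hv).mul hw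
  refine ((((hw.mul (hu.pow 2)).add huvw).const_mul p).sub
    ((((hu.pow 2).mul hv).add huvw).const_mul q)).congr_deriv ?_
  simp only [Pi.mul_apply, Pi.pow_apply]
  push_cast
  ring

/-- The y-gradient basis function `φ̃I` (varphi_I) of the 2D double-interpolation
element vanishes at all three vertices, its x-derivative vanishes at all three
vertices, and its y-derivative equals the Kronecker delta at the vertices. -/
theorem dfem2d_varphi_interpolation_conditions
    (xI yI xJ yJ xK yK : ℝ)
    (aI bI cI aJ bJ cJ aK bK cK Δ2 : ℝ)
    (haI : aI = xJ * yK - xK * yJ) (hbI : bI = yJ - yK) (hcI : cI = xK - xJ)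
    (haJ : aJ = xK * yI - xI * yK) (hbJ : bJ = yK - yI) (hcJ : cJ = xI - xK)
    (haK : aK = xI * yJ - xJ * yI) (hbK : bK = yI - yJ) (hcK : cK = xJ - xI)
    (hΔ : Δ2 = bJ * cK - bK * cJ) (hΔne : Δ2 ≠ 0)
    (LI LJ LK : ℝ → ℝ → ℝ)
    (hLI : LI = fun x y => (aI + bI * x + cI * y) / Δ2)
    (hLJ : LJ = fun x y => (aJ + bJ * x + cJ * y) / Δ2)
    (hLK : LK = fun x y => (aK + bK * x + cK * y) / Δ2)
    (φtI : ℝ → ℝ → ℝ)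
    (hφtI : φtI = fun x y =>
      bJ * (LK x y * (LI x y) ^ 2 + (1 / 2) * LI x y * LJ x y * LK x y)
        - bK * ((LI x y) ^ 2 * LJ x y + (1 / 2) * LI x y * LJ x y * LK x y)) :
    φtI xI yI = 0 ∧ φtI xJ yJ = 0 ∧ φtI xK yK = 0 ∧
    deriv (fun x => φtI x yI) xI = 0 ∧
    deriv (fun x => φtI x yJ) xJ = 0 ∧
    deriv (fun x => φtI x yK) xK = 0 ∧
    deriv (fun y => φtI xI y) yI = 1 ∧
    deriv (fun y => φtI xJ y) yJ = 0 ∧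
    deriv (fun y => φtI xK y) yK = 0 := by
  have hLI_I : LI xI yI = 1 := by
    rw [hLI, div_eq_one_iff_eq hΔne]; subst_vars; ring
  have hLI_J : LI xJ yJ = 0 := by
    rw [hLI, div_eq_zero_iff]; left; subst_vars; ring
  have hLI_K : LI xK yK = 0 := by
    rw [hLI, div_eq_zero_iff]; left; subst_vars; ring
  have hLJ_I : LJ xI yI = 0 := by
    rw [hLJ, div_eq_zero_iff]; left; subst_vars; ring
  have hLJ_K : LJ xK yK = 0 := by
    rw [hLJ, div_eq_zero_iff]; left; subst_vars; ring
  have hLK_I : LK xI yI = 0 := by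
    rw [hLK, div_eq_zero_iff]; left; subst_vars; ring
  have hLK_J : LK xJ yJ = 0 := by
    rw [hLK, div_eq_zero_iff]; left; subst_vars; ring
  have hdx (x y : ℝ) := hasDerivAt_cubicShape bJ bK (t := x) (u := fun s => LI s y)
    (v := fun s => LJ s y) (w := fun s => LK s y)
    (by rw [hLI]; exact hasDerivAt_affine_div_fst aI bI cI Δ2 x y)
    (by rw [hLJ]; exact hasDerivAt_affine_div_fst aJ bJ cJ Δ2 x y)
    (by rw [hLK]; exact hasDerivAt_affine_div_fst aK bK cK Δ2 x y)
  have hdy (x y : ℝ) := hasDerivAt_cubicShape bJ bK (t := y) (u := fun s => LI x s)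
    (v := fun s => LJ x s) (w := fun s => LK x s)
    (by rw [hLI]; exact hasDerivAt_affine_div_snd aI bI cI Δ2 x y)
    (by rw [hLJ]; exact hasDerivAt_affine_div_snd aJ bJ cJ Δ2 x y)
    (by rw [hLK]; exact hasDerivAt_affine_div_snd aK bK cK Δ2 x y)
  simp only [hφtI, (hdx _ _).deriv, (hdy _ _).deriv, hLI_I, hLI_J, hLI_K, hLJ_I, hLJ_K,
    hLK_I, hLK_J]
  refine ⟨by ring, by ring, by ring, by ring, by ring, by ring, ?_, by ring, by ring⟩
  field_simp
  rw [hΔ]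
  ring
end

section
/- The 2D double-interpolation basis reproduces affine functions exactly: for every affine function u(x, y) = α + β x + γ y and every point (x, y) ∈ ℝ², Σ_{A ∈ {I,J,K}} [ φ_A(x, y) u(x_A) + ψ_A(x, y) ∂u/∂x + φ̃_A(x, y) ∂u/∂y ] = u(x, y), where ∂u/∂x = β and ∂u/∂y = γ are the (constant) partial derivatives of u. -/
/-- The 2D double-interpolation basis reproduces affine functions exactly:
for `u(x,y) = α + β x + γ y`,
`Σ_A [φ_A u(x_A) + ψ_A ∂u/∂x + φ̃_A ∂u/∂y] = u(x,y)` at every point. -/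
theorem dfem2d_reproduces_affine
    (xI yI xJ yJ xK yK : ℝ)
    (aI bI cI aJ bJ cJ aK bK cK Δ2 : ℝ)
    (haI : aI = xJ * yK - xK * yJ) (hbI : bI = yJ - yK) (hcI : cI = xK - xJ)
    (haJ : aJ = xK * yI - xI * yK) (hbJ : bJ = yK - yI) (hcJ : cJ = xI - xK)
    (haK : aK = xI * yJ - xJ * yI) (hbK : bK = yI - yJ) (hcK : cK = xJ - xI)
    (hΔ : Δ2 = bJ * cK - bK * cJ) (hΔne : Δ2 ≠ 0)
    (LI LJ LK : ℝ → ℝ → ℝ)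
    (hLI : LI = fun x y => (aI + bI * x + cI * y) / Δ2)
    (hLJ : LJ = fun x y => (aJ + bJ * x + cJ * y) / Δ2)
    (hLK : LK = fun x y => (aK + bK * x + cK * y) / Δ2)
    (φI φJ φK ψI ψJ ψK φtI φtJ φtK : ℝ → ℝ → ℝ)
    (hφI : φI = fun x y =>
      LI x y + (LI x y) ^ 2 * LJ x y + (LI x y) ^ 2 * LK x y
        - LI x y * (LJ x y) ^ 2 - LI x y * (LK x y) ^ 2)
    (hφJ : φJ = fun x y =>
      LJ x y + (LJ x y) ^ 2 * LK x y + (LJ x y) ^ 2 * LI x y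
        - LJ x y * (LK x y) ^ 2 - LJ x y * (LI x y) ^ 2)
    (hφK : φK = fun x y =>
      LK x y + (LK x y) ^ 2 * LI x y + (LK x y) ^ 2 * LJ x y
        - LK x y * (LI x y) ^ 2 - LK x y * (LJ x y) ^ 2)
    (hψI : ψI = fun x y =>
      -cJ * (LK x y * (LI x y) ^ 2 + (1 / 2) * LI x y * LJ x y * LK x y)
        + cK * ((LI x y) ^ 2 * LJ x y + (1 / 2) * LI x y * LJ x y * LK x y))
    (hψJ : ψJ = fun x y =>
      -cK * (LI x y * (LJ x y) ^ 2 + (1 / 2) * LJ x y * LK x y * LI x y)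
        + cI * ((LJ x y) ^ 2 * LK x y + (1 / 2) * LJ x y * LK x y * LI x y))
    (hψK : ψK = fun x y =>
      -cI * (LJ x y * (LK x y) ^ 2 + (1 / 2) * LK x y * LI x y * LJ x y)
        + cJ * ((LK x y) ^ 2 * LI x y + (1 / 2) * LK x y * LI x y * LJ x y))
    (hφtI : φtI = fun x y =>
      bJ * (LK x y * (LI x y) ^ 2 + (1 / 2) * LI x y * LJ x y * LK x y)
        - bK * ((LI x y) ^ 2 * LJ x y + (1 / 2) * LI x y * LJ x y * LK x y))
    (hφtJ : φtJ = fun x y =>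
      bK * (LI x y * (LJ x y) ^ 2 + (1 / 2) * LJ x y * LK x y * LI x y)
        - bI * ((LJ x y) ^ 2 * LK x y + (1 / 2) * LJ x y * LK x y * LI x y))
    (hφtK : φtK = fun x y =>
      bI * (LJ x y * (LK x y) ^ 2 + (1 / 2) * LK x y * LI x y * LJ x y)
        - bJ * ((LK x y) ^ 2 * LI x y + (1 / 2) * LK x y * LI x y * LJ x y)) :
    ∀ α β γ x y : ℝ,
      (φI x y * (α + β * xI + γ * yI) + ψI x y * β + φtI x y * γ) +
      (φJ x y * (α + β * xJ + γ * yJ) + ψJ x y * β + φtJ x y * γ) +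
      (φK x y * (α + β * xK + γ * yK) + ψK x y * β + φtK x y * γ) =
        α + β * x + γ * y := by
  intro α β γ x y
  have hsum : LI x y + LJ x y + LK x y = 1 := by
    subst hLI hLJ hLK
    field_simp
    subst_vars
    ring
  have hx : LI x y * xI + LJ x y * xJ + LK x y * xK = x := by
    subst hLI hLJ hLK
    field_simp
    subst_vars
    ring
  have hy : LI x y * yI + LJ x y * yJ + LK x y * yK = y := by
    subst hLI hLJ hLK
    field_simp
    subst_vars
    ring
  -- The cubic terms cancel identically, leaving linear interpolation.
  rw [hφI, hφJ, hφK, hψI, hψJ, hψK, hφtI, hφtJ, hφtK, hbI, hbJ, hbK, hcI, hcJ, hcK]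
  linear_combination α * hsum + β * hx + γ * hy
end

section
/- On an element edge the 2D double-interpolation basis degenerates to the 1D cubic Hermite basis: at every point (x, y) ∈ ℝ² with L_K(x, y) = 0 (so that L_I + L_J = 1 there), the 2D basis functions satisfy φ_I(x, y) = L_I + L_I² L_J − L_I L_J², φ_J(x, y) = L_J + L_J² L_I − L_J L_I², ψ_I(x, y) = c_K L_J L_I², and ψ_J(x, y) = −c_K L_I L_J², which are exactly the 1D Hermite basis functions along edge IJ in local-coordinate form (with c = c_K = x_J − x_I). -/
/-- On the edge `IJ` (where `L_K = 0`) the 2D double-interpolation basis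
degenerates to the 1D cubic Hermite basis in local-coordinate form, with
`c = c_K = x_J − x_I`. -/
theorem dfem2d_degenerates_to_hermite_on_edge
    (xI yI xJ yJ xK yK : ℝ)
    (aI bI cI aJ bJ cJ aK bK cK Δ2 : ℝ)
    (haI : aI = xJ * yK - xK * yJ) (hbI : bI = yJ - yK) (hcI : cI = xK - xJ)
    (haJ : aJ = xK * yI - xI * yK) (hbJ : bJ = yK - yI) (hcJ : cJ = xI - xK)
    (haK : aK = xI * yJ - xJ * yI) (hbK : bK = yI - yJ) (hcK : cK = xJ - xI)
    (hΔ : Δ2 = bJ * cK - bK * cJ) (hΔne : Δ2 ≠ 0)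
    (LI LJ LK : ℝ → ℝ → ℝ)
    (hLI : LI = fun x y => (aI + bI * x + cI * y) / Δ2)
    (hLJ : LJ = fun x y => (aJ + bJ * x + cJ * y) / Δ2)
    (hLK : LK = fun x y => (aK + bK * x + cK * y) / Δ2)
    (φI φJ ψI ψJ : ℝ → ℝ → ℝ)
    (hφI : φI = fun x y =>
      LI x y + (LI x y) ^ 2 * LJ x y + (LI x y) ^ 2 * LK x y
        - LI x y * (LJ x y) ^ 2 - LI x y * (LK x y) ^ 2)
    (hφJ : φJ = fun x y =>
      LJ x y + (LJ x y) ^ 2 * LK x y + (LJ x y) ^ 2 * LI x y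
        - LJ x y * (LK x y) ^ 2 - LJ x y * (LI x y) ^ 2)
    (hψI : ψI = fun x y =>
      -cJ * (LK x y * (LI x y) ^ 2 + (1 / 2) * LI x y * LJ x y * LK x y)
        + cK * ((LI x y) ^ 2 * LJ x y + (1 / 2) * LI x y * LJ x y * LK x y))
    (hψJ : ψJ = fun x y =>
      -cK * (LI x y * (LJ x y) ^ 2 + (1 / 2) * LJ x y * LK x y * LI x y)
        + cI * ((LJ x y) ^ 2 * LK x y + (1 / 2) * LJ x y * LK x y * LI x y)) :
    ∀ x y : ℝ, LK x y = 0 →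
      LI x y + LJ x y = 1 ∧
      φI x y = LI x y + (LI x y) ^ 2 * LJ x y - LI x y * (LJ x y) ^ 2 ∧
      φJ x y = LJ x y + (LJ x y) ^ 2 * LI x y - LJ x y * (LI x y) ^ 2 ∧
      ψI x y = cK * LJ x y * (LI x y) ^ 2 ∧
      ψJ x y = -cK * LI x y * (LJ x y) ^ 2 := by
  intro x y hK
  have hsum : LI x y + LJ x y + LK x y = 1 := by
    simp only [hLI, hLJ, hLK]
    rw [← add_div, ← add_div, div_eq_one_iff_eq hΔne]
    subst_vars
    ring
  refine ⟨by rwa [hK, add_zero] at hsum, ?_, ?_, ?_, ?_⟩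
  · rw [hφI]
    simp only [hK]
    ring
  · rw [hφJ]
    simp only [hK]
    ring
  · rw [hψI]
    simp only [hK]
    ring
  · rw [hψJ]
    simp only [hK]
    ring
end
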